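/- arXiv:1410.7087 — 3 statements merged into one kernel-verified Lean document; each statement's English description precedes it below -/
import Mathlib

section
/- (Almkvist's theorem.) For every integer n > 26, the sequence b_2(n), b_3(n), …, b_{n²−2}(n) is symmetric and unimodal: b_k(n) = b_{n²−k}(n) for all 2 ≤ k ≤ n²−2, and b_{k−1}(n) ≤ b_k(n) for all integers k with 3 ≤ k ≤ n²/2. -/
/-- `b k n`: the coefficient of `q^k` in `∏_{i=1}^{n} (1 + q^(2i-1))`, i.e. the number of
partitions of `k` into distinct odd parts each at most `2n-1`. -/
noncomputable def b (k n : ℕ) : ℕ :=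
  (∏ i ∈ Finset.range n, (1 + (Polynomial.X : Polynomial ℕ) ^ (2 * i + 1))).coeff k

open Polynomial in
lemma b_succ_lt (k n : ℕ) (h : k < 2 * n + 1) : b k (n + 1) = b k n := by
  unfold b
  rw [Finset.prod_range_succ, mul_add, mul_one, coeff_add, coeff_mul_X_pow', if_neg (by omega), add_zero]

open Polynomial in
lemma b_succ_ge (k n : ℕ) : b (k + (2 * n + 1)) (n + 1) = b (k + (2 * n + 1)) n + b k n := by
  unfold b
  rw [Finset.prod_range_succ, mul_add, mul_one, coeff_add, coeff_mul_X_pow]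

lemma b_zero (k : ℕ) : b k 0 = if k = 0 then 1 else 0 := by
  simp [b, Polynomial.coeff_one]

lemma b_big (n : ℕ) : ∀ k, n ^ 2 < k → b k n = 0 := by
  induction n with
  | zero => intro k hk; rw [b_zero, if_neg (by omega)]
  | succ n ih =>
    intro k hk
    obtain ⟨j, rfl⟩ : ∃ j, k = j + (2 * n + 1) := ⟨k - (2 * n + 1), by nlinarith [Nat.sub_add_cancel (show 2 * n + 1 ≤ k by nlinarith)]⟩
    rw [b_succ_ge, ih _ (by nlinarith), ih _ (by nlinarith)]

lemma b_symm (n : ℕ) : ∀ i j, i + j = n ^ 2 → b i n = b j n := by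
  induction n with
  | zero => intro i j h; have : i = 0 ∧ j = 0 := by constructor <;> nlinarith
            rw [this.1, this.2]
  | succ n ih =>
    intro i j h
    rcases lt_or_ge i (2 * n + 1) with hi | hi <;> rcases lt_or_ge j (2 * n + 1) with hj | hj
    · have hn : n = 1 := by
        have h1 : (n + 1) ^ 2 ≤ 4 * n := by omega
        rcases Nat.lt_or_ge n 1 with h2 | h2
        · interval_cases n; omega
        · nlinarith
      subst hn
      have : i = j := by omega
      rw [this]
    · obtain ⟨l, rfl⟩ := Nat.exists_eq_add_of_le' hj
      rw [b_succ_lt _ _ hi, b_succ_ge, b_big n (l + _) (by nlinarith), zero_add]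
      exact ih _ _ (by nlinarith)
    · obtain ⟨l, rfl⟩ := Nat.exists_eq_add_of_le' hi
      rw [b_succ_lt _ _ hj, b_succ_ge, b_big n (l + _) (by nlinarith), zero_add]
      exact ih _ _ (by nlinarith)
    · obtain ⟨l, rfl⟩ := Nat.exists_eq_add_of_le' hi
      obtain ⟨r, rfl⟩ := Nat.exists_eq_add_of_le' hj
      rw [b_succ_ge, b_succ_ge, ih (l + (2 * n + 1)) r (by nlinarith),
        ih l (r + (2 * n + 1)) (by nlinarith), add_comm]

lemma b_le (n : ℕ) : ∀ k, b k n ≤ 2 ^ n := by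
  induction n with
  | zero => intro k; rw [b_zero]; split_ifs <;> simp
  | succ n ih =>
    intro k
    rcases lt_or_ge k (2 * n + 1) with h | h
    · rw [b_succ_lt _ _ h]; have := ih k; rw [pow_succ]; omega
    · obtain ⟨j, rfl⟩ := Nat.exists_eq_add_of_le' h
      rw [b_succ_ge, pow_succ]; have := ih j; have := ih (j + (2 * n + 1)); omega

def go (X : ℕ) : ℕ → ℕ → Bool
  | 0, _ => true
  | f + 1, w => Nat.ble (w % X) (w / X % X) && go X f (w / X)

def pk (X : ℕ) : ℕ → ℕ
  | 0 => 1
  | n + 1 => pk X n + pk X n * X ^ (2 * n + 1)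

def loop (X : ℕ) : ℕ → ℕ → ℕ → Bool
  | 0, _, _ => true
  | f + 1, n, p => go X (n ^ 2 / 2 - (n - 1) ^ 2 / 2) (p / X ^ ((n - 1) ^ 2 / 2)) && loop X f (n + 1) (p + p * X ^ (2 * n + 1))

lemma t27 : go (2^136) 362 (pk (2^136) 27 / (2^136)^2) = true := by decide +kernel
lemma t28 : go (2^136) 390 (pk (2^136) 28 / (2^136)^2) = true := by decide +kernel
lemma t29 : go (2^136) 418 (pk (2^136) 29 / (2^136)^2) = true := by decide +kernel
lemma t30 : go (2^136) 448 (pk (2^136) 30 / (2^136)^2) = true := by decide +kernel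
lemma t31 : loop (2^136) 100 31 (pk (2^136) 31) = true := by decide +kernel

lemma go_spec (X f : ℕ) : ∀ w, go X f w = true → ∀ i < f, w / X ^ i % X ≤ w / X ^ (i + 1) % X := by
  induction f with
  | zero => intro w _ i hi; omega
  | succ f ih =>
    intro w h i hi
    simp only [go, Bool.and_eq_true, Nat.ble_eq] at h
    cases i with
    | zero => simpa using h.1
    | succ i =>
      have := ih _ h.2 i (by omega)
      rw [Nat.div_div_eq_div_mul, Nat.div_div_eq_div_mul, ← pow_succ', ← pow_succ'] at this
      exact this

lemma loop_spec (X f : ℕ) : ∀ n, loop X f n (pk X n) = true → ∀ i < f,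
    go X ((n + i) ^ 2 / 2 - (n + i - 1) ^ 2 / 2) (pk X (n + i) / X ^ ((n + i - 1) ^ 2 / 2)) = true := by
  induction f with
  | zero => intro w _ i hi; omega
  | succ f ih =>
    intro n h i hi
    rw [loop, Bool.and_eq_true] at h
    cases i with
    | zero => simpa using h.1
    | succ i =>
      have := ih (n + 1) h.2 i (by omega)
      rw [show n + 1 + i = n + (i + 1) by ring] at this
      exact this

open Polynomial in
lemma pk_eval (X n : ℕ) : pk X n =
    (∏ i ∈ Finset.range n, (1 + (Polynomial.X : Polynomial ℕ) ^ (2 * i + 1))).eval X := by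
  induction n with
  | zero => simp [pk]
  | succ n ih => rw [pk, Finset.prod_range_succ, eval_mul, ← ih]; simp; ring

open Polynomial in
lemma digit (B : ℕ) (k : ℕ) : ∀ p : ℕ[X], (∀ i, p.coeff i < B) →
    p.eval B / B ^ k % B = p.coeff k := by
  induction k with
  | zero =>
    intro p hp
    conv_lhs => rw [← p.divX_mul_X_add]
    simp [Nat.mod_eq_of_lt (hp 0)]
  | succ k ih =>
    intro p hp
    have hB : 0 < B := lt_of_le_of_lt (Nat.zero_le _) (hp 0)
    rw [pow_succ', ← Nat.div_div_eq_div_mul]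
    conv_lhs => rw [← p.divX_mul_X_add]
    rw [eval_add, eval_mul, eval_X, eval_C, add_comm, Nat.add_mul_div_right _ _ hB,
      Nat.div_eq_of_lt (hp 0), zero_add, ih _ (fun i => by rw [coeff_divX]; exact hp _), coeff_divX]

lemma pk_digit (k n : ℕ) (hn : n < 136) : pk (2^136) n / (2^136) ^ k % (2^136) = b k n := by
  rw [pk_eval]
  exact digit _ _ _ (fun i => lt_of_le_of_lt (b_le n i) (Nat.pow_lt_pow_right (by norm_num) hn))

lemma go_b (n j f : ℕ) (hn : n < 136) (h : go (2^136) f (pk (2^136) n / (2^136) ^ j) = true)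
    (k : ℕ) (h1 : j < k) (h2 : k ≤ j + f) : b (k - 1) n ≤ b k n := by
  have := go_spec _ _ _ h (k - 1 - j) (by omega)
  rw [Nat.div_div_eq_div_mul, Nat.div_div_eq_div_mul, ← pow_add, ← pow_add, pk_digit _ _ hn,
    pk_digit _ _ hn] at this
  rwa [show j + (k - 1 - j) = k - 1 by omega, show j + (k - 1 - j + 1) = k by omega] at this

lemma window_small (n k : ℕ) (h1 : 31 ≤ n) (h2 : n ≤ 130) (h3 : (n - 1) ^ 2 < 2 * k)
    (h4 : 2 * k ≤ n ^ 2) : b (k - 1) n ≤ b k n := by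
  have := loop_spec _ _ _ t31 (n - 31) (by omega)
  rw [show 31 + (n - 31) = n by omega] at this
  exact go_b _ _ _ (by omega) this k (by omega) (by omega)

lemma base (n k : ℕ) (h1 : 27 ≤ n) (h2 : n ≤ 30) (h3 : 3 ≤ k)
    (h4 : 2 * k ≤ n ^ 2) : b (k - 1) n ≤ b k n := by
  interval_cases n
  · exact go_b _ _ _ (by omega) t27 k (by omega) (by omega)
  · exact go_b _ _ _ (by omega) t28 k (by omega) (by omega)
  · exact go_b _ _ _ (by omega) t29 k (by omega) (by omega)
  · exact go_b _ _ _ (by omega) t30 k (by omega) (by omega)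

lemma b_stab (k n m : ℕ) (h : k < 2 * n + 1) : b k (n + m) = b k n := by
  induction m with
  | zero => rfl
  | succ m ih => rw [← add_assoc, b_succ_lt _ _ (by omega), ih]

lemma b_small (k n : ℕ) (hk : k < 11) (hn : 5 ≤ n) : b k n = pk (2^136) 5 / (2^136) ^ k % (2^136) := by
  obtain ⟨m, rfl⟩ := Nat.exists_eq_add_of_le hn
  rw [b_stab _ _ _ (by omega), pk_digit _ _ (by norm_num)]

def S (n : ℕ) : Prop := ∀ k : ℕ, 3 ≤ k → 2 * k ≤ n ^ 2 → b (k - 1) n ≤ b k n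

lemma strict (m : ℕ) (hm : 27 ≤ m) (h : S m) :
    b (2 * (m + 3) + 2) (m + 3) + 1 ≤ b (2 * (m + 3) + 3) (m + 3) := by
  have e : ∀ n, 5 ≤ n → b 3 n = 1 ∧ b 4 n = 1 ∧ b 5 n = 1 ∧ b 6 n = 1 ∧ b 7 n = 1 ∧ b 8 n = 2 := by
    intro n hn
    refine ⟨?_, ?_, ?_, ?_, ?_, ?_⟩ <;> rw [b_small _ _ (by omega) hn] <;> decide +kernel
  have h1 := h (2 * (m + 3) + 3) (by omega) (by nlinarith)
  rw [show 2 * (m + 3) + 3 - 1 = 2 * (m + 3) + 2 by omega] at h1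
  have a1 := b_succ_ge 3 (m + 2)
  have a2 := b_succ_ge 4 (m + 2)
  have a3 := b_succ_ge 5 (m + 1)
  have a4 := b_succ_ge 6 (m + 1)
  have a5 := b_succ_ge 7 m
  have a6 := b_succ_ge 8 m
  obtain ⟨c1, c2, -⟩ := e (m + 2) (by omega)
  obtain ⟨-, -, c3, c4, -⟩ := e (m + 1) (by omega)
  obtain ⟨-, -, -, -, c5, c6⟩ := e m (by omega)
  rw [c1] at a1; rw [c2] at a2; rw [c3] at a3; rw [c4] at a4; rw [c5] at a5; rw [c6] at a6
  ring_nf at *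
  omega

lemma step (n : ℕ) (hn : 30 ≤ n) (h3 : S (n - 3)) (h : S n)
    (hw : ∀ k, n ^ 2 < 2 * k → 2 * k ≤ (n + 1) ^ 2 → b (k - 1) (n + 1) ≤ b k (n + 1)) :
    S (n + 1) := by
  intro k hk hk2
  rcases lt_or_ge (n ^ 2) (2 * k) with h1 | h1
  · exact hw k h1 hk2
  have h2 := h k hk h1
  rcases lt_or_ge k (2 * n + 1) with h4 | h4
  · rwa [b_succ_lt _ _ h4, b_succ_lt _ _ (by omega)]
  obtain ⟨l, rfl⟩ := Nat.exists_eq_add_of_le' h4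
  rw [b_succ_ge]
  rcases Nat.eq_zero_or_pos l with h5 | h5
  · subst h5
    rw [b_succ_lt _ _ (by omega)]; omega
  rw [show l + (2 * n + 1) - 1 = (l - 1) + (2 * n + 1) by omega] at h2 ⊢
  rw [b_succ_ge]
  rcases lt_or_ge l 3 with h6 | h6
  · have e : b 0 n = 1 ∧ b 1 n = 1 ∧ b 2 n = 0 := by
      refine ⟨?_, ?_, ?_⟩ <;> rw [b_small _ _ (by omega) (by omega)] <;> decide +kernel
    interval_cases l
    · simp only [e]; omega
    · have := strict (n - 3) (by omega) h3
      rw [show n - 3 + 3 = n by omega] at this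
      simp only [e]
      ring_nf at *
      omega
  · have := h l h6 (by omega)
    omega

lemma all (hw : ∀ n k, 131 ≤ n → (n - 1) ^ 2 < 2 * k → 2 * k ≤ n ^ 2 → b (k - 1) n ≤ b k n) :
    ∀ n, 27 ≤ n → S n := by
  intro n
  induction n using Nat.strong_induction_on with
  | _ n ih =>
    intro hn
    rcases le_or_gt n 30 with h | h
    · exact fun k h3 h4 => base n k hn h h3 h4
    · obtain ⟨m, rfl⟩ : ∃ m, n = m + 1 := ⟨n - 1, by omega⟩
      apply step m (by omega) (ih _ (by omega) (by omega)) (ih _ (by omega) (by omega))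
      intro k h1 h2
      rcases le_or_gt (m + 1) 130 with h5 | h5
      · exact window_small _ _ (by omega) h5 h1 h2
      · exact hw _ _ (by omega) h1 h2

open Real

noncomputable def CC (n : ℕ) (x : ℝ) : ℝ := ∏ j ∈ Finset.range n, cos ((2 * j + 1) * x)

lemma CC_cont (n : ℕ) : Continuous (CC n) := by
  unfold CC; fun_prop

lemma CC_neg (n : ℕ) (x : ℝ) : CC n (-x) = CC n x := by
  unfold CC; simp

lemma CC_sum (n : ℕ) (x : ℝ) :
    4 * sin (2 * x) * ∑ j ∈ Finset.range n, cos ((2 * j + 1) * x) ^ 2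
      = 2 * n * sin (2 * x) + sin (4 * n * x) := by
  induction n with
  | zero => simp
  | succ n ih =>
    rw [Finset.sum_range_succ, mul_add, ih]
    have h1 : cos ((2 * n + 1) * x) ^ 2 = 1 / 2 + cos (4 * n * x + 2 * x) / 2 := by
      rw [cos_sq]; congr 3; ring
    have h2 : sin (4 * (n + 1 : ℕ) * x) = sin ((4 * n * x + 2 * x) + 2 * x) := by
      congr 1; push_cast; ring
    have h3 : sin (4 * n * x) = sin ((4 * n * x + 2 * x) - 2 * x) := by congr 1; ring
    rw [h1, h2, h3, sin_add, sin_sub]; push_cast; ring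

lemma sin_small (n : ℕ) (hn : 131 ≤ n) : 3 / (2 * n) ≤ sin (π / (2 * n)) := by
  have hn' : (131 : ℝ) ≤ n := by exact_mod_cast hn
  set u := π / (2 * n) with hu
  have h1 : u ≤ 1 / 50 := by
    rw [hu, div_le_div_iff₀ (by positivity) (by norm_num)]; linarith [pi_lt_d2]
  have h0 : 0 < u := by positivity
  have h2 : (157 / 100) / n ≤ u := by
    rw [hu, div_le_div_iff₀ (by positivity) (by positivity)]; nlinarith [pi_gt_d2]
  have h3 := sin_gt_sub_cube h0
  have h4 : u ^ 3 ≤ u / 2500 := by nlinarith [mul_pos h0 h0]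
  have h5 : 3 / (2 * (n : ℝ)) ≤ (156 / 100) / n := by
    rw [div_le_div_iff₀ (by positivity) (by positivity)]; nlinarith
  have h6 : (156 / 100) / (n : ℝ) ≤ 156 / 157 * u := by
    calc (156 / 100) / (n : ℝ) = 156 / 157 * ((157 / 100) / n) := by ring
      _ ≤ _ := by gcongr
  linarith

lemma key_sin (n : ℕ) (hn : 131 ≤ n) (x : ℝ) (h1 : π / (4 * n) ≤ x) (h2 : x < π / 2) :
    sin (4 * n * x) ≤ 2 * n / 3 * sin (2 * x) := by
  have hn' : (131 : ℝ) ≤ n := by exact_mod_cast hn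
  have hx : 0 < x := lt_of_lt_of_le (by positivity) h1
  have hs : 0 < sin (2 * x) := sin_pos_of_pos_of_lt_pi (by linarith) (by linarith)
  have hp : 0 < 2 * n / 3 * sin (2 * x) := by positivity
  rw [div_le_iff₀ (by positivity)] at h1
  rcases le_or_gt (4 * n * x) (2 * π) with h3 | h3
  · have : 0 ≤ sin (4 * n * x - π) := sin_nonneg_of_nonneg_of_le_pi (by linarith) (by linarith)
    rw [sin_sub_pi] at this; linarith
  rcases le_or_gt (4 * n * (π / 2 - x)) π with h4 | h4
  · have h5 : 0 ≤ sin (4 * n * (π / 2 - x)) :=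
      sin_nonneg_of_nonneg_of_le_pi (mul_nonneg (by positivity) (by linarith)) h4
    have h6 : sin (4 * n * x) = - sin (4 * n * (π / 2 - x)) := by
      rw [show 4 * n * (π / 2 - x) = n * (2 * π) - 4 * n * x by ring, sin_nat_mul_two_pi_sub]
      ring
    linarith
  · have h5 : sin (π / (2 * n)) ≤ sin (2 * x) := by
      have a1 : π / (2 * n) ≤ 2 * x := by
        rw [div_le_iff₀ (by positivity)]; nlinarith [pi_pos]
      have a2 : π / (2 * n) ≤ π - 2 * x := by
        rw [div_le_iff₀ (by positivity)]; nlinarith [pi_pos]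
      have a3 : 0 < π / (2 * n) := by positivity
      rcases le_or_gt (2 * x) (π / 2) with h6 | h6
      · exact sin_le_sin_of_le_of_le_pi_div_two (by linarith) h6 a1
      · rw [← sin_pi_sub (2 * x)]
        exact sin_le_sin_of_le_of_le_pi_div_two (by linarith) (by linarith) a2
    have h6 := sin_small n hn
    calc sin (4 * n * x) ≤ 1 := sin_le_one _
      _ = 2 * n / 3 * (3 / (2 * n)) := by field_simp
      _ ≤ _ := by gcongr; linarith

lemma tail_sq (n : ℕ) (hn : 131 ≤ n) (x : ℝ) (h1 : π / (4 * n) ≤ x) (h2 : x ≤ π / 2) :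
    CC n x ^ 2 ≤ (2 / 3) ^ n := by
  have hn' : (131 : ℝ) ≤ n := by exact_mod_cast hn
  rcases h2.lt_or_eq with h2 | h2
  swap
  · have : CC n x = 0 := by
      unfold CC
      apply Finset.prod_eq_zero (i := 0) (Finset.mem_range.2 (by omega))
      simp [h2]
    rw [this, zero_pow two_ne_zero]; positivity
  have hx : 0 < x := lt_of_lt_of_le (by positivity) h1
  have hs : 0 < sin (2 * x) := sin_pos_of_pos_of_lt_pi (by linarith) (by linarith)
  have hk := key_sin n hn x h1 h2
  have hS : ∑ j ∈ Finset.range n, cos ((2 * j + 1) * x) ^ 2 ≤ 2 / 3 * n := by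
    have := CC_sum n x
    by_contra hc
    push Not at hc
    nlinarith [mul_lt_mul_of_pos_left hc hs]
  have hP : ∏ j ∈ Finset.range n, (3 / 2 * cos ((2 * j + 1) * x) ^ 2) ≤ 1 := by
    calc ∏ j ∈ Finset.range n, (3 / 2 * cos ((2 * j + 1) * x) ^ 2)
        ≤ ∏ j ∈ Finset.range n, exp (3 / 2 * cos ((2 * j + 1) * x) ^ 2 - 1) := by
          apply Finset.prod_le_prod
          · intros; positivity
          · intro j _
            linarith [add_one_le_exp (3 / 2 * cos ((2 * j + 1) * x) ^ 2 - 1)]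
      _ = exp (3 / 2 * ∑ j ∈ Finset.range n, cos ((2 * j + 1) * x) ^ 2 - n) := by
          rw [← exp_sum, Finset.sum_sub_distrib, ← Finset.mul_sum]; simp
      _ ≤ 1 := by rw [exp_le_one_iff]; linarith
  rw [Finset.prod_mul_distrib, Finset.prod_pow] at hP
  simp only [Finset.prod_const, Finset.card_range] at hP
  change (3 / 2 : ℝ) ^ n * CC n x ^ 2 ≤ 1 at hP
  calc CC n x ^ 2 = (2 / 3) ^ n * ((3 / 2 : ℝ) ^ n * CC n x ^ 2) := by
        rw [← mul_assoc, ← mul_pow]; norm_num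
    _ ≤ (2 / 3) ^ n * 1 := by gcongr
    _ = _ := mul_one _

lemma sin_lin (M : ℕ) (x : ℝ) : |sin (M * x)| ≤ M * |sin x| := by
  induction M with
  | zero => simp
  | succ M ih =>
    push_cast
    rw [add_mul, one_mul, sin_add]
    have a := abs_add_le (sin (M * x) * cos x) (cos (M * x) * sin x)
    rw [abs_mul, abs_mul] at a
    have b1 := abs_cos_le_one x
    have b2 := abs_cos_le_one (M * x)
    nlinarith [abs_nonneg (sin (M * x)), abs_nonneg (sin x)]

lemma CC_nonneg (n : ℕ) (hn : 131 ≤ n) (x : ℝ) (h0 : 0 ≤ x) (h1 : x ≤ π / (4 * n)) : 0 ≤ CC n x := by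
  have hn' : (131 : ℝ) ≤ n := by exact_mod_cast hn
  rw [le_div_iff₀ (by positivity)] at h1
  apply Finset.prod_nonneg
  intro j hj
  have : (j : ℝ) + 1 ≤ n := by exact_mod_cast Finset.mem_range.1 hj
  apply cos_nonneg_of_neg_pi_div_two_le_of_le
  · have : 0 ≤ (2 * j + 1) * x := by positivity
    linarith [pi_pos]
  · nlinarith

lemma CC_low (n : ℕ) (x : ℝ) (h0 : 0 ≤ x) (h1 : x * (2 * n) ≤ π / 2) :
    0 ≤ CC n x ∧ CC n x ≤ 1 ∧ 1 - x ^ 2 / 6 * (n * (4 * n ^ 2 - 1)) ≤ CC n x := by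
  induction n with
  | zero => simp [CC]
  | succ n ih =>
    push_cast at h1
    obtain ⟨a, b, c⟩ := ih (by nlinarith)
    have e : CC (n + 1) x = CC n x * cos ((2 * n + 1) * x) := by
      unfold CC; rw [Finset.prod_range_succ]
    have d0 : 0 ≤ cos ((2 * n + 1) * x) := by
      apply cos_nonneg_of_neg_pi_div_two_le_of_le
      · have : 0 ≤ (2 * n + 1) * x := by positivity
        linarith [pi_pos]
      · nlinarith
    have d1 := cos_le_one ((2 * n + 1) * x)
    have d2 := one_sub_sq_div_two_le_cos (x := (2 * n + 1) * x)
    rw [e]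
    refine ⟨by positivity, by nlinarith, ?_⟩
    push_cast
    nlinarith [mul_nonneg (sub_nonneg.2 b) (sub_nonneg.2 d1)]

lemma num (n : ℕ) (hn : 131 ≤ n) : 305 * (n : ℝ) ^ 9 * (2 / 3) ^ n ≤ 1 := by
  induction n, hn using Nat.le_induction with
  | base => norm_num
  | succ n hn ih =>
    have hn' : (131 : ℝ) ≤ n := by exact_mod_cast hn
    have h1 : ((n + 1 : ℕ) : ℝ) ^ 9 ≤ 3 / 2 * (n : ℝ) ^ 9 := by
      calc ((n + 1 : ℕ) : ℝ) ^ 9 ≤ (132 / 131 * n) ^ 9 := by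
            gcongr; push_cast; linarith
        _ = (132 / 131) ^ 9 * (n : ℝ) ^ 9 := by rw [mul_pow]
        _ ≤ _ := by gcongr; norm_num
    calc _ ≤ 305 * (3 / 2 * (n : ℝ) ^ 9) * (2 / 3) ^ (n + 1) := by gcongr
      _ = 305 * (n : ℝ) ^ 9 * (2 / 3) ^ n := by rw [pow_succ]; ring
      _ ≤ 1 := ih

set_option maxHeartbeats 1000000 in
lemma integral_nonneg' (n M : ℕ) (hn : 131 ≤ n) (hM : M ≤ 2 * n) :
    0 ≤ ∫ x in (0 : ℝ)..(π / 2), CC n x * (sin (M * x) * sin x) := by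
  have hn' : (131 : ℝ) ≤ n := by exact_mod_cast hn
  have hM' : (M : ℝ) ≤ 2 * n := by exact_mod_cast hM
  set f : ℝ → ℝ := fun x => CC n x * (sin (M * x) * sin x) with hf
  have hc : Continuous f := by have := CC_cont n; fun_prop
  have hi : ∀ u v, IntervalIntegrable f MeasureTheory.volume u v := fun u v => hc.intervalIntegrable u v
  set r := √(n : ℝ) with hr
  have hr2 : r ^ 2 = n := sq_sqrt (by positivity)
  have hr11 : 11 ≤ r := le_sqrt_of_sq_le (by linarith)
  set a : ℝ := 1 / r ^ 3 with ha
  have ha0 : 0 < a := by positivity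
  have ha2 : a ^ 2 * n ^ 3 = 1 := by rw [ha, ← hr2]; field_simp
  have han : a * n ≤ 1 / 11 := by
    rw [ha, ← hr2]
    have : 1 / r ^ 3 * r ^ 2 = 1 / r := by field_simp
    rw [this]; exact one_div_le_one_div_of_le (by norm_num) hr11
  set p := π / (4 * n) with hp
  have hap : a ≤ p := by
    rw [hp, le_div_iff₀ (by positivity)]; nlinarith [pi_gt_three]
  have hp2 : p ≤ π / 2 := by
    rw [hp]; exact div_le_div_of_nonneg_left pi_pos.le (by norm_num) (by linarith)
  set R := √((2 / 3 : ℝ) ^ n) with hR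
  have hR2 : R ^ 2 = (2 / 3 : ℝ) ^ n := sq_sqrt (by positivity)
  have hR0 : 0 ≤ R := sqrt_nonneg _
  have I1 : M * (27 / 100) * (a ^ 3 / 3) ≤ ∫ x in (0 : ℝ)..a, f x := by
    have : ∫ x in (0 : ℝ)..a, M * (27 / 100) * x ^ 2 = M * (27 / 100) * (a ^ 3 / 3) := by
      rw [intervalIntegral.integral_const_mul, integral_pow]; norm_num
    rw [← this]
    apply intervalIntegral.integral_mono_on ha0.le (Continuous.intervalIntegrable (by fun_prop) _ _) (hi _ _)
    intro x hx
    obtain ⟨x0, xa⟩ := hx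
    have xn : x * n ≤ 1 / 11 := le_trans (by gcongr) han
    have C1 : 1 / 3 ≤ CC n x := by
      have := (CC_low n x x0 (by nlinarith [pi_gt_three])).2.2
      have q : x ^ 2 * n ^ 3 ≤ 1 := by rw [← ha2]; gcongr
      nlinarith [mul_nonneg (sq_nonneg x) (Nat.cast_nonneg (α := ℝ) n)]
    have sl : ∀ y : ℝ, 0 ≤ y → y ≤ 1 / 5 → 9 / 10 * y ≤ sin y := by
      intro y y0 y1
      rcases y0.eq_or_lt with h | h
      · simp [← h]
      · have := sin_gt_sub_cube h
        nlinarith [mul_nonneg y0 y0]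
    have s1 := sl x x0 (by nlinarith)
    have s2 := sl (M * x) (by positivity) (by nlinarith)
    calc M * (27 / 100) * x ^ 2 = 1 / 3 * ((9 / 10 * (M * x)) * (9 / 10 * x)) := by ring
      _ ≤ f x := by
        simp only [hf]
        have : 0 ≤ sin (M * x) := le_trans (by positivity) s2
        gcongr
  have I2 : 0 ≤ ∫ x in a..p, f x := by
    apply intervalIntegral.integral_nonneg hap
    intro x hx
    have x0 : 0 ≤ x := ha0.le.trans hx.1
    have c := CC_nonneg n hn x x0 hx.2
    have hx2 := hx.2
    rw [hp, le_div_iff₀ (by positivity)] at hx2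
    have s1 : 0 ≤ sin x := sin_nonneg_of_nonneg_of_le_pi x0 (by nlinarith)
    have s2 : 0 ≤ sin (M * x) := sin_nonneg_of_nonneg_of_le_pi (by positivity) (by nlinarith)
    exact mul_nonneg c (mul_nonneg s2 s1)
  have I3 : -(M * R * (π / 2)) ≤ ∫ x in p..(π / 2), f x := by
    have h1 : ∫ x in p..(π / 2), (-(M * R) : ℝ) = (π / 2 - p) * -(M * R) := by
      rw [intervalIntegral.integral_const, smul_eq_mul]
    have h2 : ∫ x in p..(π / 2), (-(M * R) : ℝ) ≤ ∫ x in p..(π / 2), f x := by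
      apply intervalIntegral.integral_mono_on hp2 (Continuous.intervalIntegrable (by fun_prop) _ _) (hi _ _)
      intro x hx
      have c : |CC n x| ≤ R := by
        refine abs_le_of_sq_le_sq ?_ hR0
        rw [hR2]; exact tail_sq n hn x hx.1 hx.2
      have s1 := abs_sin_le_one x
      have s2 : |sin (M * x)| ≤ M := (sin_lin M x).trans (by nlinarith [Nat.cast_nonneg (α := ℝ) M])
      have : |f x| ≤ R * (M * 1) := by
        simp only [hf]; rw [abs_mul, abs_mul]; gcongr
      linarith [(abs_le.1 this).1]
    have : 0 ≤ p * (M * R) := by positivity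
    linarith
  have hfin : R * (π / 2) ≤ 9 / 100 * a ^ 3 := by
    refine (pow_le_pow_iff_left₀ (by positivity) (by positivity) two_ne_zero).1 ?_
    have h1 : (9 / 100 * a ^ 3) ^ 2 = 81 / 10000 * (1 / (n : ℝ) ^ 9) := by
      have : a ^ 2 = 1 / (n : ℝ) ^ 3 := by field_simp; exact ha2
      calc (9 / 100 * a ^ 3) ^ 2 = 81 / 10000 * (a ^ 2) ^ 3 := by ring
        _ = _ := by rw [this]; ring
    have h2 : (2 / 3 : ℝ) ^ n ≤ 1 / 305 * (1 / (n : ℝ) ^ 9) := by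
      have := num n hn
      rw [one_div_mul_one_div, le_div_iff₀ (by positivity)]; linarith
    rw [h1, mul_pow, hR2]
    have h3 : (π / 2) ^ 2 ≤ 2.47 := by nlinarith [pi_lt_d4, pi_pos]
    have h4 : 0 ≤ 1 / (n : ℝ) ^ 9 := by positivity
    calc _ ≤ 1 / 305 * (1 / (n : ℝ) ^ 9) * 2.47 := by gcongr
      _ ≤ _ := by linarith
  have hsplit : ∫ x in (0 : ℝ)..(π / 2), f x
      = (∫ x in (0 : ℝ)..a, f x) + (∫ x in a..p, f x) + ∫ x in p..(π / 2), f x := by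
    rw [intervalIntegral.integral_add_adjacent_intervals (hi _ _) (hi _ _),
      intervalIntegral.integral_add_adjacent_intervals (hi _ _) (hi _ _)]
  rw [hsplit]
  nlinarith [mul_le_mul_of_nonneg_left hfin (Nat.cast_nonneg (α := ℝ) M)]

open Polynomial in
lemma b_eval (n : ℕ) (z : ℂ) : ∑ k ∈ Finset.range (n ^ 2 + 1), (b k n : ℂ) * z ^ k
    = ∏ j ∈ Finset.range n, (1 + z ^ (2 * j + 1)) := by
  set P := ∏ i ∈ Finset.range n, (1 + (Polynomial.X : Polynomial ℕ) ^ (2 * i + 1)) with hP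
  have hd : P.natDegree < n ^ 2 + 1 := by
    rw [Nat.lt_succ_iff, natDegree_le_iff_coeff_eq_zero]
    exact fun k hk => b_big n k hk
  have h1 : eval₂ (Nat.castRingHom ℂ) z P = ∏ j ∈ Finset.range n, (1 + z ^ (2 * j + 1)) := by
    rw [hP, eval₂_finsetProd]; simp
  rw [← h1, eval₂_eq_sum_range' _ hd]
  rfl

lemma b_fourier (n k0 : ℕ) (x : ℝ) :
    ∑ k ∈ Finset.range (n ^ 2 + 1), (b k n : ℝ) * cos (2 * ((k : ℝ) - k0) * x)
      = 2 ^ n * (CC n x * cos (((n : ℝ) ^ 2 - 2 * k0) * x)) := by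
  have hprod : ∀ m : ℕ, ∏ j ∈ Finset.range m, (1 + Complex.exp (2 * x * Complex.I) ^ (2 * j + 1))
      = Complex.exp (((m : ℝ) ^ 2 * x : ℝ) * Complex.I) * ((2 ^ m * CC m x : ℝ) : ℂ) := by
    intro m
    induction m with
    | zero => simp [CC]
    | succ m ih =>
      have e : CC (m + 1) x = CC m x * cos ((2 * m + 1) * x) := by
        unfold CC; rw [Finset.prod_range_succ]
      have e2 : 1 + Complex.exp (2 * x * Complex.I) ^ (2 * m + 1)
          = Complex.exp ((2 * m + 1) * x * Complex.I) * (2 * Complex.cos ((2 * m + 1) * x)) := by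
        rw [Complex.two_cos, mul_add, ← Complex.exp_add, ← Complex.exp_add, ← Complex.exp_nat_mul,
          add_comm]
        congr 1
        · congr 1; push_cast; ring
        · rw [← Complex.exp_zero]; congr 1; ring
      rw [Finset.prod_range_succ, ih, e, e2]
      have e3 : Complex.exp ((((m + 1 : ℕ) : ℝ) ^ 2 * x : ℝ) * Complex.I) =
          Complex.exp (((m : ℝ) ^ 2 * x : ℝ) * Complex.I) * Complex.exp ((2 * m + 1) * x * Complex.I) := by
        rw [← Complex.exp_add]; congr 1; push_cast; ring
      rw [e3]; push_cast; ring
  have h := b_eval n (Complex.exp (2 * x * Complex.I))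
  rw [hprod] at h
  have h2 := congrArg (fun w => (w * Complex.exp ((-(2 * k0 * x) : ℝ) * Complex.I)).re) h
  simp only [Finset.sum_mul, Complex.re_sum] at h2
  have hl : ∀ k : ℕ, ((b k n : ℂ) * Complex.exp (2 * x * Complex.I) ^ k
      * Complex.exp ((-(2 * k0 * x) : ℝ) * Complex.I)).re = (b k n : ℝ) * cos (2 * ((k : ℝ) - k0) * x) := by
    intro k
    have : (b k n : ℂ) * Complex.exp (2 * x * Complex.I) ^ k
      * Complex.exp ((-(2 * k0 * x) : ℝ) * Complex.I)
      = ((b k n : ℝ) : ℂ) * Complex.exp ((2 * ((k : ℝ) - k0) * x : ℝ) * Complex.I) := by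
      rw [mul_assoc, ← Complex.exp_nat_mul, ← Complex.exp_add]
      push_cast
      congr 2; ring
    rw [this, Complex.re_ofReal_mul, Complex.exp_ofReal_mul_I_re]
  simp only [hl] at h2
  rw [h2]
  have : Complex.exp (((n : ℝ) ^ 2 * x : ℝ) * Complex.I) * ((2 ^ n * CC n x : ℝ) : ℂ)
      * Complex.exp ((-(2 * k0 * x) : ℝ) * Complex.I)
      = ((2 ^ n * CC n x : ℝ) : ℂ) * Complex.exp ((((n : ℝ) ^ 2 - 2 * k0) * x : ℝ) * Complex.I) := by
    rw [mul_right_comm, ← Complex.exp_add, mul_comm]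
    congr 2; push_cast; ring
  rw [this, Complex.re_ofReal_mul, Complex.exp_ofReal_mul_I_re]
  ring

lemma orth (m : ℤ) : ∫ x in (-(π / 2))..(π / 2), cos (2 * (m : ℝ) * x) = if m = 0 then π else 0 := by
  split_ifs with h
  · simp [h]
  · have hm : (2 * (m : ℝ)) ≠ 0 := by simpa using h
    rw [intervalIntegral.integral_comp_mul_left (fun x => cos x) hm, integral_cos]
    have e1 : sin (2 * (m : ℝ) * (π / 2)) = 0 := by
      rw [show 2 * (m : ℝ) * (π / 2) = m * π by ring]; exact sin_int_mul_pi m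
    have e2 : sin (2 * (m : ℝ) * -(π / 2)) = 0 := by
      rw [mul_neg, sin_neg, e1, neg_zero]
    rw [e1, e2]; simp

lemma b_int (n k0 : ℕ) (hk : k0 ≤ n ^ 2) : π * b k0 n =
    2 ^ n * ∫ x in (-(π / 2))..(π / 2), CC n x * cos (((n : ℝ) ^ 2 - 2 * k0) * x) := by
  rw [← intervalIntegral.integral_const_mul]
  simp only [← b_fourier]
  rw [intervalIntegral.integral_finsetSum]
  · have : ∀ k : ℕ, ∫ x in (-(π / 2))..(π / 2), (b k n : ℝ) * cos (2 * ((k : ℝ) - k0) * x)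
        = if k = k0 then π * b k n else 0 := by
      intro k
      rw [intervalIntegral.integral_const_mul]
      have := orth ((k : ℤ) - k0)
      push_cast at this
      rw [this]
      by_cases h : k = k0
      · simp [h, mul_comm]
      · have : ¬ ((k : ℤ) - k0 = 0) := by omega
        simp [h, this]
    simp only [this]
    rw [Finset.sum_ite_eq' , if_pos (Finset.mem_range.2 (by omega))]
  · intro k _
    exact Continuous.intervalIntegrable (by fun_prop) _ _

lemma window_big (n k : ℕ) (hn : 131 ≤ n) (h1 : (n - 1) ^ 2 < 2 * k) (h2 : 2 * k ≤ n ^ 2) :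
    b (k - 1) n ≤ b k n := by
  obtain ⟨k, rfl⟩ : ∃ l, k = l + 1 := ⟨k - 1, by omega⟩
  rw [Nat.add_sub_cancel]
  obtain ⟨t, ht⟩ := Nat.exists_eq_add_of_le h2
  obtain ⟨m, rfl⟩ : ∃ m, n = m + 1 := ⟨n - 1, by omega⟩
  rw [Nat.add_sub_cancel] at h1
  have hM : t + 1 ≤ 2 * (m + 1) := by nlinarith
  have hI := integral_nonneg' (m + 1) (t + 1) hn hM
  set n := m + 1 with hn0
  have ht' : (n : ℝ) ^ 2 = 2 * (k + 1) + t := by exact_mod_cast ht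
  have hc := CC_cont n
  have hE : ∫ x in (-(π / 2))..(π / 2), CC n x * (sin ((t + 1 : ℕ) * x) * sin x)
      = 2 * ∫ x in (0 : ℝ)..(π / 2), CC n x * (sin ((t + 1 : ℕ) * x) * sin x) := by
    have hi : ∀ u v, IntervalIntegrable (fun x => CC n x * (sin ((t + 1 : ℕ) * x) * sin x))
      MeasureTheory.volume u v := fun u v => Continuous.intervalIntegrable (by fun_prop) u v
    rw [← intervalIntegral.integral_add_adjacent_intervals (hi _ 0) (hi 0 _), two_mul]
    congr 1
    have := intervalIntegral.integral_comp_neg (a := 0) (b := π / 2)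
      (fun x => CC n x * (sin ((t + 1 : ℕ) * x) * sin x))
    rw [neg_zero] at this
    rw [← this]
    congr 1; ext x
    rw [CC_neg, mul_neg, sin_neg, sin_neg]; ring
  have hd : π * b (k + 1) n - π * b k n
      = 2 ^ n * (2 * ∫ x in (-(π / 2))..(π / 2), CC n x * (sin ((t + 1 : ℕ) * x) * sin x)) := by
    rw [b_int n (k + 1) (by omega), b_int n k (by omega), ← mul_sub,
      ← intervalIntegral.integral_sub (Continuous.intervalIntegrable (by fun_prop) _ _)
        (Continuous.intervalIntegrable (by fun_prop) _ _)]
    congr 1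
    rw [← intervalIntegral.integral_const_mul]
    apply intervalIntegral.integral_congr
    intro x _
    simp only []
    rw [ht']
    have e1 : (2 * ((k : ℝ) + 1) + t - 2 * ((k + 1 : ℕ) : ℝ)) * x = (t + 1 : ℕ) * x - x := by
      push_cast; ring
    have e2 : (2 * ((k : ℝ) + 1) + t - 2 * (k : ℝ)) * x = (t + 1 : ℕ) * x + x := by
      push_cast; ring
    rw [e1, e2, cos_sub, cos_add]; ring
  rw [hE] at hd
  have h0 : 0 ≤ π * b (k + 1) n - π * b k n := by rw [hd]; positivity
  have : (b k n : ℝ) ≤ b (k + 1) n := le_of_mul_le_mul_left (by linarith) pi_pos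
  exact_mod_cast this

theorem stmt_6 (n : ℕ) (hn : 26 < n) :
    (∀ k : ℕ, 2 ≤ k → k ≤ n ^ 2 - 2 → b k n = b (n ^ 2 - k) n) ∧
    (∀ k : ℕ, 3 ≤ k → 2 * k ≤ n ^ 2 → b (k - 1) n ≤ b k n) := by
  refine ⟨fun k h1 h2 => b_symm n _ _ (by omega), all window_big n hn⟩
end

section
/- For every integer n ≥ 2 and every integer k with 3 ≤ k ≤ 2n+1, the following identities hold in ℤ: if k ≠ 2n−1 and k ≠ 2n+1 then b_k(n) − b_{k−1}(n) = b_k(n−1) − b_{k−1}(n−1); if k = 2n−1 then b_k(n) − b_{k−1}(n) = b_k(n−1) − b_{k−1}(n−1) + 1; and if k = 2n+1 then b_k(n) − b_{k−1}(n) = b_k(n−1) − b_{k−1}(n−1) − 1. -/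
theorem b_succ_aux (k m : ℕ) :
    b k (m + 1) = b k m + if 2 * m + 1 ≤ k then b (k - (2 * m + 1)) m else 0 := by
  unfold b
  rw [Finset.prod_range_succ, mul_add, mul_one, Polynomial.coeff_add, Polynomial.coeff_mul_X_pow']

theorem b_small_aux (m : ℕ) : b 0 (m + 1) = 1 ∧ b 1 (m + 1) = 1 ∧ b 2 (m + 1) = 0 := by
  induction m with
  | zero => simp [b, Polynomial.coeff_one, Polynomial.coeff_X]
  | succ m ih =>
    obtain ⟨h0, h1, h2⟩ := ih
    refine ⟨?_, ?_, ?_⟩ <;> rw [b_succ_aux, if_neg (by omega)] <;> simpa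

theorem stmt_7 (n k : ℕ) (hn : 2 ≤ n) (hk3 : 3 ≤ k) (hk : k ≤ 2 * n + 1) :
    (k ≠ 2 * n - 1 → k ≠ 2 * n + 1 →
      (b k n : ℤ) - b (k - 1) n = (b k (n - 1) : ℤ) - b (k - 1) (n - 1)) ∧
    (k = 2 * n - 1 →
      (b k n : ℤ) - b (k - 1) n = (b k (n - 1) : ℤ) - b (k - 1) (n - 1) + 1) ∧
    (k = 2 * n + 1 →
      (b k n : ℤ) - b (k - 1) n = (b k (n - 1) : ℤ) - b (k - 1) (n - 1) - 1) := by
  obtain ⟨m, rfl⟩ : ∃ m, n = m + 1 + 1 := ⟨n - 2, by omega⟩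
  obtain ⟨h0, h1, h2⟩ := b_small_aux m
  rw [b_succ_aux k (m + 1), b_succ_aux (k - 1) (m + 1)]
  simp only [Nat.add_sub_cancel]
  refine ⟨fun ha hb => ?_, fun ha => ?_, fun ha => ?_⟩
  · by_cases hc : k = 2 * (m + 1 + 1)
    · rw [if_pos (by omega), if_pos (by omega),
        show k - (2 * (m + 1) + 1) = 1 by omega, show k - 1 - (2 * (m + 1) + 1) = 0 by omega, h0, h1]
      push_cast; ring
    · rw [if_neg (by omega), if_neg (by omega)]
      push_cast; ring
  · rw [if_pos (by omega), if_neg (by omega), show k - (2 * (m + 1) + 1) = 0 by omega, h0]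
    push_cast; ring
  · rw [if_pos (by omega), if_pos (by omega),
      show k - (2 * (m + 1) + 1) = 2 by omega, show k - 1 - (2 * (m + 1) + 1) = 1 by omega, h1, h2]
    push_cast; ring
end

section
/- For every integer n ≥ 86 and every integer k with (n−1)²/2 ≤ k ≤ n²/2, we have b_k(n) − b_{k−1}(n) ≥ C · 2^n / n^{9/2}, where C = 3√3/(2√2 · π^{3/2}). -/
open Real intervalIntegral

namespace Aux9

noncomputable def P (n : ℕ) (t : ℝ) : ℝ := ∏ i ∈ Finset.range n, cos ((2 * i + 1) * t)

lemma P_cont (n : ℕ) : Continuous (P n) := by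
  unfold P; fun_prop

lemma P_succ (n : ℕ) (t : ℝ) : P (n+1) t = P n t * cos ((2 * n + 1) * t) := by
  unfold P; rw [Finset.prod_range_succ]

noncomputable def bz (n : ℕ) (k : ℤ) : ℝ := if 0 ≤ k then (b k.toNat n : ℝ) else 0

lemma b_succ (k n : ℕ) : b k (n+1) = b k n + if 2 * n + 1 ≤ k then b (k - (2 * n + 1)) n else 0 := by
  unfold b
  rw [Finset.prod_range_succ, mul_add, mul_one, Polynomial.coeff_add, Polynomial.coeff_mul_X_pow']

lemma bz_succ (n : ℕ) (k : ℤ) : bz (n+1) k = bz n k + bz n (k - (2 * n + 1)) := by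
  unfold bz
  by_cases hk : 0 ≤ k
  · obtain ⟨k, rfl⟩ := Int.eq_ofNat_of_zero_le hk
    rw [if_pos hk, if_pos hk, Int.toNat_natCast, b_succ]
    by_cases h : 2 * n + 1 ≤ k
    · have h2 : (0:ℤ) ≤ (k:ℤ) - (2 * n + 1) := by omega
      have h3 : ((k:ℤ) - (2 * n + 1)).toNat = k - (2 * n + 1) := by omega
      rw [if_pos h, if_pos h2, h3]; push_cast; ring
    · have h2 : ¬ (0:ℤ) ≤ (k:ℤ) - (2 * n + 1) := by omega
      rw [if_neg h, if_neg h2]; simp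
  · have h2 : ¬ (0:ℤ) ≤ (k:ℤ) - (2 * n + 1) := by omega
    rw [if_neg hk, if_neg hk, if_neg h2]; simp

lemma bz_zero (k : ℤ) : bz 0 k = if k = 0 then 1 else 0 := by
  unfold bz b
  simp only [Finset.range_zero, Finset.prod_empty, Polynomial.coeff_one]
  by_cases h : k = 0
  · simp [h]
  · rw [if_neg h]
    by_cases h0 : 0 ≤ k
    · rw [if_pos h0, if_neg (by omega)]; simp
    · rw [if_neg h0]

lemma fourier (n : ℕ) : ∀ k : ℤ,
    ∫ t in (0:ℝ)..(π/2), 2 ^ n * P n t * cos (((n:ℝ)^2 - 2 * k) * t) = π / 2 * bz n k := by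
  induction n with
  | zero =>
    intro k
    rw [bz_zero]
    by_cases h : k = 0
    · simp [h, P]
    · have hk : (k:ℝ) ≠ 0 := by exact_mod_cast h
      have h2 : ((0:ℕ):ℝ)^2 - 2 * (k:ℝ) ≠ 0 := by simpa using hk
      simp only [P, Finset.range_zero, Finset.prod_empty, pow_zero, one_mul, if_neg h]
      rw [intervalIntegral.integral_comp_mul_left (fun x => cos x) h2, integral_cos]
      have : (((0:ℕ):ℝ)^2 - 2 * (k:ℝ)) * (π/2) = -(k * π) := by push_cast; ring
      rw [this, sin_neg, sin_int_mul_pi]; simp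
  | succ n ih =>
    intro k
    rw [bz_succ, mul_add, ← ih, ← ih, ← intervalIntegral.integral_add]
    · congr 1; ext t
      rw [P_succ]
      have e1 : (((n:ℝ)^2 - 2 * k) * t) = (((n+1:ℕ):ℝ)^2 - 2 * k) * t - (2 * n + 1) * t := by
        push_cast; ring
      have e2 : (((n:ℝ)^2 - 2 * ((k - (2 * n + 1) : ℤ):ℝ)) * t)
          = (((n+1:ℕ):ℝ)^2 - 2 * k) * t + (2 * n + 1) * t := by
        push_cast; ring
      rw [e1, e2, cos_add, cos_sub]; ring
    · have := P_cont n
      exact Continuous.intervalIntegrable (by fun_prop) _ _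
    · have := P_cont n
      exact Continuous.intervalIntegrable (by fun_prop) _ _

lemma diff_eq (n k : ℕ) (hk : 1 ≤ k) :
    (b k n : ℝ) - b (k-1) n = 2 ^ n * (4 / π) *
      ∫ t in (0:ℝ)..(π/2), P n t * (sin (((n:ℝ)^2 - 2 * k + 1) * t) * sin t) := by
  have h1 := fourier n (k:ℤ)
  have h2 := fourier n ((k - 1 : ℕ):ℤ)
  have e1 : bz n (k:ℤ) = b k n := by simp [bz]
  have e2 : bz n ((k - 1 : ℕ):ℤ) = b (k-1) n := by simp only [bz, Int.toNat_natCast]; simp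
  rw [e1] at h1; rw [e2] at h2
  have hc := P_cont n
  have h3 : ∫ t in (0:ℝ)..(π/2), 2 * 2 ^ n * (P n t * (sin (((n:ℝ)^2 - 2 * k + 1) * t) * sin t))
      = π / 2 * b k n - π/2 * b (k-1) n := by
    rw [← h1, ← h2, ← intervalIntegral.integral_sub]
    · congr 1; ext t
      have a1 : (((n:ℝ)^2 - 2 * ((k:ℤ):ℝ)) * t) = ((n:ℝ)^2 - 2 * k + 1) * t - t := by
        push_cast; ring
      have a2 : (((n:ℝ)^2 - 2 * (((k - 1:ℕ):ℤ):ℝ)) * t) = ((n:ℝ)^2 - 2 * k + 1) * t + t := by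
        push_cast [hk]; ring
      rw [a1, a2, cos_add, cos_sub]; ring
    · exact Continuous.intervalIntegrable (by fun_prop) _ _
    · exact Continuous.intervalIntegrable (by fun_prop) _ _
  rw [intervalIntegral.integral_const_mul] at h3
  have := pi_pos
  generalize (∫ t in (0:ℝ)..(π/2), P n t * (sin (((n:ℝ)^2 - 2 * k + 1) * t) * sin t)) = J at h3 ⊢
  field_simp
  linarith

lemma sum_cos_sq (n : ℕ) (t : ℝ) :
    4 * sin (2 * t) * ∑ i ∈ Finset.range n, cos ((2 * i + 1) * t) ^ 2
      = 2 * n * sin (2 * t) + sin (4 * n * t) := by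
  induction n with
  | zero => simp
  | succ n ih =>
    rw [Finset.sum_range_succ, mul_add, ih]
    have e1 : 4 * ((n+1:ℕ):ℝ) * t = 2 * ((2 * n + 1) * t) + 2 * t := by push_cast; ring
    have e2 : 4 * (n:ℝ) * t = 2 * ((2 * n + 1) * t) - 2 * t := by ring
    have e3 := cos_sq ((2 * (n:ℝ) + 1) * t)
    rw [e1, e2, sin_add, sin_sub, e3]; push_cast; ring

lemma P_sq_le (n : ℕ) (t R : ℝ) (hR : 0 < R)
    (h : ∑ i ∈ Finset.range n, cos ((2 * i + 1) * t) ^ 2 ≤ R * n) : (P n t)^2 ≤ R ^ n := by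
  unfold P
  rw [← Finset.prod_pow]
  calc ∏ i ∈ Finset.range n, cos ((2 * i + 1) * t) ^ 2
      ≤ ∏ i ∈ Finset.range n, R * exp (cos ((2 * i + 1) * t) ^ 2 / R - 1) := by
        apply Finset.prod_le_prod
        · intros; positivity
        · intro i _
          have := add_one_le_exp (cos ((2 * i + 1) * t) ^ 2 / R - 1)
          calc cos ((2 * i + 1) * t) ^ 2 = R * (cos ((2 * i + 1) * t) ^ 2 / R - 1 + 1) := by
                field_simp; ring
            _ ≤ _ := by gcongr
    _ = R ^ n * exp (∑ i ∈ Finset.range n, (cos ((2 * i + 1) * t) ^ 2 / R - 1)) := by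
        rw [Finset.prod_mul_distrib, exp_sum]; simp
    _ ≤ R ^ n * 1 := by
        gcongr
        rw [exp_le_one_iff, Finset.sum_sub_distrib, ← Finset.sum_div]
        simp only [Finset.sum_const, Finset.card_range, nsmul_eq_mul, mul_one]
        rw [sub_nonpos, div_le_iff₀ hR]; linarith
    _ = R ^ n := mul_one _

lemma P_bound (n : ℕ) (t R : ℝ) (hR : 0 < R) (hs : 0 < sin (2 * t))
    (h : sin (4 * n * t) ≤ (4 * R - 2) * n * sin (2 * t)) : |P n t| ≤ √(R ^ n) := by
  apply abs_le_sqrt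
  apply P_sq_le n t R hR
  have := sum_cos_sq n t
  have h4 : 4 * sin (2 * t) * ∑ i ∈ Finset.range n, cos ((2 * i + 1) * t) ^ 2
      ≤ 4 * sin (2 * t) * (R * n) := by rw [this]; linarith
  exact le_of_mul_le_mul_left h4 (by positivity)

lemma num1 (n : ℕ) (hn : 86 ≤ n) : (0.582:ℝ) ^ n * (n:ℝ) ^ 9 ≤ 0.04 ^ 2 := by
  induction n, hn using Nat.le_induction with
  | base => norm_num
  | succ n hn ih =>
    have hn' : (86:ℝ) ≤ n := by exact_mod_cast hn
    have : ((n+1:ℕ):ℝ) ≤ 87/86 * n := by push_cast; linarith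
    calc (0.582:ℝ) ^ (n+1) * ((n+1:ℕ):ℝ) ^ 9 ≤ 0.582 ^ (n+1) * (87/86 * n) ^ 9 := by gcongr
      _ = (0.582 ^ n * (n:ℝ)^9) * (0.582 * (87/86)^9) := by ring
      _ ≤ (0.582 ^ n * (n:ℝ)^9) * 1 := by gcongr; norm_num
      _ ≤ _ := by linarith

lemma num2 (n : ℕ) (hn : 86 ≤ n) : (0.626:ℝ) ^ n * (n:ℝ) ^ 9 ≤ 1 ^ 2 := by
  induction n, hn using Nat.le_induction with
  | base => norm_num
  | succ n hn ih =>
    have hn' : (86:ℝ) ≤ n := by exact_mod_cast hn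
    have : ((n+1:ℕ):ℝ) ≤ 87/86 * n := by push_cast; linarith
    calc (0.626:ℝ) ^ (n+1) * ((n+1:ℕ):ℝ) ^ 9 ≤ 0.626 ^ (n+1) * (87/86 * n) ^ 9 := by gcongr
      _ = (0.626 ^ n * (n:ℝ)^9) * (0.626 * (87/86)^9) := by ring
      _ ≤ (0.626 ^ n * (n:ℝ)^9) * 1 := by gcongr; norm_num
      _ ≤ _ := by linarith

lemma sqrt_num (n : ℕ) (hn : 86 ≤ n) (R e : ℝ) (he : 0 ≤ e) (h : R ^ n * (n:ℝ)^9 ≤ e ^ 2) :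
    √(R ^ n) ≤ e / ((n:ℝ)^4 * √n) := by
  have hn' : (0:ℝ) < n := by exact_mod_cast (by omega : 0 < n)
  apply sqrt_le_iff.2 ⟨by positivity, ?_⟩
  rw [div_pow, mul_pow, sq_sqrt hn'.le, le_div_iff₀ (by positivity)]
  calc _ = R ^ n * (n:ℝ)^9 := by ring
    _ ≤ _ := h

lemma reg1 (n : ℕ) (hn : 86 ≤ n) (t : ℝ) (h1 : π / (4 * n) ≤ t) (h2 : t ≤ π / 2 - π / (2 * n)) :
    |P n t| ≤ 0.04 / ((n:ℝ)^4 * √n) := by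
  have hn' : (86:ℝ) ≤ n := by exact_mod_cast hn
  have hn0 : (0:ℝ) < n := by linarith
  have hp := pi_pos
  have hp3 := pi_gt_d2
  have hp4 := pi_lt_d2
  have ht0 : 0 < t := lt_of_lt_of_le (by positivity) h1
  have hd : 0 < π / (2 * n) := by positivity
  have h1' : π ≤ 4 * n * t := by
    rw [div_le_iff₀ (by positivity)] at h1; linarith
  have hs : 0 < sin (2 * t) := sin_pos_of_pos_of_lt_pi (by linarith) (by linarith)
  refine le_trans (P_bound n t 0.582 (by norm_num) hs ?_) (sqrt_num n hn _ _ (by norm_num) (num1 n hn))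
  by_cases h : 4 * n * t ≤ 2 * π
  · have : sin (4 * n * t) ≤ 0 := by
      rw [← sin_sub_two_pi]
      exact sin_nonpos_of_nonpos_of_neg_pi_le (by linarith) (by linarith)
    have h5 : (0:ℝ) ≤ (4 * 0.582 - 2) * n * sin (2 * t) := by
      have : (0:ℝ) < 4 * 0.582 - 2 := by norm_num
      positivity
    linarith
  · push Not at h
    have hy1 : π / n ≤ 2 * t := by
      rw [div_le_iff₀ hn0]; linarith
    have hy2 : 2 * t ≤ π - π / n := by
      have : π / (2 * n) = π / n / 2 := by field_simp
      linarith
    have hy0 : 0 < π / n := by positivity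
    have hy3 : π / n ≤ 0.037 := by
      rw [div_le_iff₀ hn0]; linarith
    have hb : 3.1 / n ≤ sin (π / n) := by
      have h6 := sin_gt_sub_cube hy0
      have h7 : (π / n) ^ 3 ≤ (π / n) * 0.037 ^ 2 := by
        have : (π / n) ^ 2 ≤ 0.037 ^ 2 := by gcongr
        nlinarith
      have h8 : 3.1 / n ≤ (π / n) * 0.99 := by
        rw [div_mul_eq_mul_div]; gcongr; linarith
      linarith
    have hmono : sin (π / n) ≤ sin (2 * t) := by
      by_cases hh : 2 * t ≤ π / 2
      · exact sin_le_sin_of_le_of_le_pi_div_two (by linarith) hh hy1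
      · rw [← sin_pi_sub (2 * t)]
        exact sin_le_sin_of_le_of_le_pi_div_two (by linarith) (by linarith) (by linarith)
    have h9 : 3.1 ≤ n * sin (2 * t) := by
      have : 3.1 / n ≤ sin (2 * t) := hb.trans hmono
      rw [div_le_iff₀ hn0] at this; linarith
    have := sin_le_one (4 * n * t)
    nlinarith

lemma neg_sin_le (w : ℝ) (hw : 0 ≤ w) : - sin w ≤ w / 4 := by
  have hp3 := pi_gt_d2
  by_cases h : w ≤ π
  · have := sin_nonneg_of_nonneg_of_le_pi hw h; linarith
  · push Not at h
    rw [← sin_sub_pi]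
    by_cases h1 : w - π ≤ 1
    · have := sin_le (x := w - π) (by linarith); linarith
    · have := sin_le_one (w - π); linarith

lemma reg2 (n : ℕ) (hn : 86 ≤ n) (t : ℝ) (h1 : π / 2 - π / (2 * n) ≤ t) (h2 : t < π / 2) :
    |P n t| ≤ 1 / ((n:ℝ)^4 * √n) := by
  have hn' : (86:ℝ) ≤ n := by exact_mod_cast hn
  have hn0 : (0:ℝ) < n := by linarith
  have hp := pi_pos
  have hp3 := pi_gt_d2
  have hp4 := pi_lt_d2
  obtain ⟨y, hy⟩ : ∃ y, y = π - 2 * t := ⟨_, rfl⟩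
  have hy0 : 0 < y := by linarith
  have hyn : y ≤ π / n := by
    have : π / (2 * n) = π / n / 2 := by field_simp
    linarith
  have hy3 : y ≤ 0.037 := by
    refine hyn.trans ?_
    rw [div_le_iff₀ hn0]; linarith
  have ht : 2 * t = π - y := by linarith
  have e1 : sin (2 * t) = sin y := by rw [ht, sin_pi_sub]
  have e2 : sin (4 * n * t) = - sin (2 * n * y) := by
    have : 4 * n * t = n * (2 * π) - 2 * n * y := by rw [hy]; ring
    rw [this, sin_nat_mul_two_pi_sub]
  have hs : 0.999 * y ≤ sin y := by
    have h6 := sin_gt_sub_cube hy0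
    have h7 : y ^ 3 ≤ y * 0.037 ^ 2 := by
      have : y ^ 2 ≤ 0.037 ^ 2 := by gcongr
      nlinarith
    linarith
  refine le_trans (P_bound n t 0.626 (by norm_num) (by rw [e1]; linarith) ?_)
    (sqrt_num n hn _ _ (by norm_num) (num2 n hn))
  rw [e1, e2]
  have := neg_sin_le (2 * n * y) (by positivity)
  have h8 : (n:ℝ) * (0.999 * y) ≤ n * sin y := by gcongr
  nlinarith

lemma exp_le_one_sub (u : ℝ) (h0 : 0 ≤ u) (h1 : u ≤ 0.122) : exp (-(u / 0.878)) ≤ 1 - u := by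
  rw [exp_neg]
  have := add_one_le_exp (u / 0.878)
  apply inv_le_of_inv_le₀ (by linarith)
  refine le_trans ?_ this
  rw [inv_le_iff_one_le_mul₀ (by linarith)]
  have : u / 0.878 = u * (500/439) := by norm_num [div_eq_mul_inv]
  rw [this]
  nlinarith

lemma sum_odd_sq (n : ℕ) : ∑ i ∈ Finset.range n, (2 * (i:ℝ) + 1)^2 ≤ 4 / 3 * (n:ℝ)^3 := by
  induction n with
  | zero => simp
  | succ n ih =>
    rw [Finset.sum_range_succ]; push_cast
    have : (0:ℝ) ≤ n := by positivity
    nlinarith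

lemma P_lower (n : ℕ) (hn : 86 ≤ n) (t s : ℝ) (hs : s ^ 2 * 2.29 ^ 2 = (n:ℝ)^3 * t ^ 2)
    (hs1 : s ^ 2 ≤ 1) : (1 - s^2)^4 ≤ P n t := by
  have hn' : (86:ℝ) ≤ n := by exact_mod_cast hn
  have hn0 : (0:ℝ) < n := by linarith
  have hu : ∀ i ∈ Finset.range n, ((2 * (i:ℝ) + 1) * t)^2 / 2 ≤ 0.122 := by
    intro i hi
    have hi' : (i:ℝ) + 1 ≤ n := by exact_mod_cast Finset.mem_range.1 hi
    have h1 : (2 * (i:ℝ) + 1) ≤ 2 * n := by linarith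
    have h2 : (2 * (i:ℝ) + 1)^2 ≤ (2 * n)^2 := by gcongr
    have h3 : (n:ℝ)^2 * t^2 ≤ 2.29^2 / 86 := by
      have : (n:ℝ) * (n^2 * t^2) ≤ 2.29^2 := by nlinarith
      have h5 : 86 * ((n:ℝ)^2 * t^2) ≤ n * (n^2 * t^2) := by gcongr
      linarith
    have h4 : (2 * (i:ℝ) + 1)^2 * t^2 ≤ (2 * n)^2 * t^2 := by gcongr
    rw [mul_pow]; norm_num at h3 ⊢; linarith
  calc (1 - s^2)^4 ≤ (exp (-s^2))^4 := by
        apply pow_le_pow_left₀ (by linarith)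
        exact one_sub_le_exp_neg _
    _ = exp (-(4 * s^2)) := by rw [← exp_nat_mul]; congr 1; push_cast; ring
    _ ≤ exp (∑ i ∈ Finset.range n, -(((2 * (i:ℝ) + 1) * t)^2 / 2 / 0.878)) := by
        apply exp_le_exp.2
        rw [Finset.sum_neg_distrib, neg_le_neg_iff, ← Finset.sum_div, ← Finset.sum_div]
        simp_rw [mul_pow]
        rw [← Finset.sum_mul]
        have := sum_odd_sq n
        have h6 : (∑ i ∈ Finset.range n, (2 * (i:ℝ) + 1)^2) * t^2 ≤ 4 / 3 * (n:ℝ)^3 * t^2 := by gcongr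
        rw [div_le_iff₀ (by norm_num), div_le_iff₀ (by norm_num)]
        nlinarith
    _ = ∏ i ∈ Finset.range n, exp (-(((2 * (i:ℝ) + 1) * t)^2 / 2 / 0.878)) := exp_sum _ _
    _ ≤ P n t := by
        unfold P
        apply Finset.prod_le_prod
        · intros; positivity
        · intro i hi
          exact (exp_le_one_sub _ (by positivity) (hu i hi)).trans one_sub_sq_div_two_le_cos

lemma P_nonneg (n : ℕ) (t : ℝ) (h0 : 0 ≤ t) (h : 4 * n * t ≤ π) : 0 ≤ P n t := by
  unfold P
  apply Finset.prod_nonneg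
  intro i hi
  have hi' : (i:ℝ) + 1 ≤ n := by exact_mod_cast Finset.mem_range.1 hi
  have hp := pi_pos
  have : (2 * (i:ℝ) + 1) * t ≤ 2 * n * t := by gcongr; linarith
  have h3 : 0 ≤ (2 * (i:ℝ) + 1) * t := by positivity
  exact cos_nonneg_of_neg_pi_div_two_le_of_le (by linarith) (by linarith)

lemma poly_int (T : ℝ) (hT : 0 < T) :
    ∫ t in (0:ℝ)..T, (1 - (t / T)^2)^4 * (0.99 * t^2) = 0.99 * (128/3465) * T^3 := by
  have hd : ∀ x ∈ Set.uIcc 0 T, HasDerivAt (fun t : ℝ => 0.99 * T^3 * ((t/T)^3/3 - 4 * (t/T)^5/5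
      + 6 * (t/T)^7/7 - 4 * (t/T)^9/9 + (t/T)^11/11)) ((1 - (x / T)^2)^4 * (0.99 * x^2)) x := by
    intro x _
    have hx : HasDerivAt (fun t : ℝ => t / T) (1 / T) x := (hasDerivAt_id x).div_const T
    have := ((((((hx.pow 3).div_const 3).sub (((hx.pow 5).const_mul 4).div_const 5)).add
      (((hx.pow 7).const_mul 6).div_const 7)).sub (((hx.pow 9).const_mul 4).div_const 9)).add
      ((hx.pow 11).div_const 11)).const_mul (0.99 * T^3)
    refine HasDerivAt.congr_deriv this ?_
    have hTT : T * T⁻¹ = 1 := mul_inv_cancel₀ hT.ne'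
    have e : x = T * (x / T) := by field_simp
    have e1 : T ^ 3 * (1 / T) = T ^ 2 := by field_simp
    have e2 : x ^ 2 = T ^ 2 * (x / T) ^ 2 := by rw [← mul_pow, ← e]
    rw [e2, ← e1]
    norm_num
    ring
  rw [integral_eq_sub_of_hasDerivAt hd (Continuous.intervalIntegrable (by fun_prop) _ _)]
  rw [div_self hT.ne']
  norm_num
  ring

set_option maxHeartbeats 1000000 in
lemma main_int (n : ℕ) (hn : 86 ≤ n) (M : ℝ) (hM1 : 1 ≤ M) (hM2 : M ≤ 2 * n) :
    0.35 / ((n:ℝ)^4 * √n) ≤ ∫ t in (0:ℝ)..(π/2), P n t * (sin (M * t) * sin t) := by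
  have hn' : (86:ℝ) ≤ n := by exact_mod_cast hn
  have hn0 : (0:ℝ) < n := by linarith
  have hp := pi_pos
  have hp3 := pi_gt_d2
  have hp4 := pi_lt_d2
  have hc := P_cont n
  have hsq : √(n:ℝ) ^ 2 = n := sq_sqrt hn0.le
  have hsp : 0 < √(n:ℝ) := sqrt_pos.2 hn0
  have hs9 : 9 ≤ √(n:ℝ) := le_sqrt_of_sq_le (by linarith)
  set Q := (n:ℝ)^4 * √n with hQ
  have hQ0 : 0 < Q := by positivity
  obtain ⟨T, hT⟩ : ∃ T, T = 2.29 / (n * √(n:ℝ)) := ⟨_, rfl⟩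
  have hT0 : 0 < T := by rw [hT]; positivity
  have hT2 : (n:ℝ)^3 * T^2 = 2.29^2 := by
    rw [hT, div_pow, mul_pow, hsq]; field_simp
  have hT3 : T^3 = 2.29^3 / Q := by
    rw [hT, div_pow, hQ]
    congr 1
    calc (n * √(n:ℝ))^3 = n^3 * √(n:ℝ)^2 * √n := by ring
      _ = _ := by rw [hsq]; ring
  have hTn : n * T ≤ 0.3 := by
    have : n * T * √(n:ℝ) = 2.29 := by rw [hT]; field_simp
    have h3 : 0 < n * T := by positivity
    nlinarith
  obtain ⟨a, ha⟩ : ∃ a, a = π / (4 * n) := ⟨_, rfl⟩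
  obtain ⟨c, hcc⟩ : ∃ c, c = π / 2 - π / (2 * n) := ⟨_, rfl⟩
  have ha4 : 4 * n * a = π := by rw [ha]; field_simp
  have hTa : T ≤ a := by
    have : n * T ≤ n * a := by linarith
    exact le_of_mul_le_mul_left this hn0
  have ha1 : a ≤ 0.01 := by nlinarith
  have hc2 : π / (2 * n) = 2 * a := by rw [ha]; field_simp; ring
  have hac : a ≤ c := by linarith
  have hcp : c ≤ π / 2 := by linarith
  have hint : ∀ x y : ℝ, IntervalIntegrable (fun t => P n t * (sin (M * t) * sin t))
      MeasureTheory.volume x y := fun x y => Continuous.intervalIntegrable (by fun_prop) _ _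
  rw [← integral_add_adjacent_intervals (hint 0 T) (hint T (π/2)),
    ← integral_add_adjacent_intervals (hint T a) (hint a (π/2)),
    ← integral_add_adjacent_intervals (hint a c) (hint c (π/2))]
  have habs : ∀ t, |P n t * (sin (M * t) * sin t)| ≤ |P n t| := by
    intro t
    rw [abs_mul, abs_mul]
    have h1 := abs_sin_le_one (M * t)
    have h2 := abs_sin_le_one t
    have : |sin (M * t)| * |sin t| ≤ 1 := mul_le_one₀ h1 (abs_nonneg _) h2
    exact mul_le_of_le_one_right (abs_nonneg _) this
  have I1 : 0.99 * (128/3465) * T^3 ≤ ∫ t in (0:ℝ)..T, P n t * (sin (M * t) * sin t) := by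
    rw [← poly_int T hT0]
    apply integral_mono_on hT0.le (Continuous.intervalIntegrable (by fun_prop) _ _) (hint _ _)
    intro t ht
    obtain ⟨ht0, ht1⟩ := ht
    have hst : (1 - (t/T)^2)^4 ≤ P n t := by
      apply P_lower n hn t (t/T)
      · rw [← hT2]; field_simp
      · rw [div_pow, div_le_one (by positivity)]; gcongr
    rcases ht0.eq_or_lt with rfl | ht0
    · simp
    have h1 : 0.995 * t ≤ sin t := by
      have h6 := sin_gt_sub_cube ht0
      have h7 : t ^ 3 ≤ t * 0.01 ^ 2 := by
        have : t ^ 2 ≤ 0.01 ^ 2 := by gcongr; linarith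
        nlinarith
      linarith
    have h2 : sin t ≤ sin (M * t) := by
      apply sin_le_sin_of_le_of_le_pi_div_two (by linarith)
      · have : M * t ≤ 2 * n * a := by gcongr; linarith
        linarith
      · nlinarith
    have h3 : 0.99 * t^2 ≤ sin (M * t) * sin t := by
      have : (0.995 * t) * (0.995 * t) ≤ sin (M * t) * sin t := by
        apply mul_le_mul (by linarith) h1 (by positivity) (le_trans (by positivity) (h1.trans h2))
      nlinarith
    exact mul_le_mul hst h3 (by positivity) (le_trans (by positivity) hst)
  have I2 : 0 ≤ ∫ t in T..a, P n t * (sin (M * t) * sin t) := by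
    apply integral_nonneg hTa
    intro t ht
    obtain ⟨ht0, ht1⟩ := ht
    have ht00 : 0 ≤ t := by linarith
    apply mul_nonneg
    · apply P_nonneg n t ht00
      rw [← ha4]; gcongr
    · apply mul_nonneg
      · apply sin_nonneg_of_nonneg_of_le_pi (by positivity)
        have : M * t ≤ 2 * n * a := by gcongr
        linarith
      · exact sin_nonneg_of_nonneg_of_le_pi ht00 (by linarith)
  have I3 : -(0.04 / Q * (c - a)) ≤ ∫ t in a..c, P n t * (sin (M * t) * sin t) := by
    have : ∫ t in a..c, (-(0.04 / Q)) = -(0.04 / Q * (c - a)) := by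
      rw [integral_const, smul_eq_mul]; ring
    rw [← this]
    apply integral_mono_on hac (by simp) (hint _ _)
    intro t ht
    have h1 := reg1 n hn t (by rw [← ha]; exact ht.1) (by rw [← hcc]; exact ht.2)
    have h2 := neg_abs_le (P n t * (sin (M * t) * sin t))
    have := habs t
    linarith
  have I4 : -(1 / Q * (π / 2 - c)) ≤ ∫ t in c..(π/2), P n t * (sin (M * t) * sin t) := by
    have : ∫ t in c..(π/2), (-(1 / Q)) = -(1 / Q * (π / 2 - c)) := by
      rw [integral_const, smul_eq_mul]; ring
    rw [← this]
    apply integral_mono_on_of_le_Ioo hcp (by simp) (hint _ _)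
    intro t ht
    have h1 := reg2 n hn t (by rw [← hcc]; exact ht.1.le) ht.2
    have h2 := neg_abs_le (P n t * (sin (M * t) * sin t))
    have := habs t
    linarith
  have hq : 0 < 1 / Q := by positivity
  have J1 : 0.99 * (128/3465) * T^3 = 0.99 * (128/3465) * 2.29^3 * (1 / Q) := by rw [hT3]; ring
  have J3 : 0.04 / Q * (c - a) ≤ 0.064 * (1 / Q) := by
    have : 0.04 / Q * (c - a) = (0.04 * (c - a)) * (1 / Q) := by ring
    rw [this]; gcongr; linarith
  have J4 : 1 / Q * (π / 2 - c) ≤ 0.02 * (1 / Q) := by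
    rw [mul_comm]; gcongr; linarith
  have J0 : 0.35 / Q = 0.35 * (1 / Q) := by ring
  rw [J0]
  linarith

end Aux9

theorem stmt_9 (n k : ℕ) (hn : 86 ≤ n) (hk1 : (n - 1) ^ 2 ≤ 2 * k) (hk2 : 2 * k ≤ n ^ 2) :
    (b k n : ℝ) - b (k - 1) n ≥
      (3 * Real.sqrt 3 / (2 * Real.sqrt 2 * Real.pi ^ ((3 : ℝ) / 2))) *
        2 ^ n / (n : ℝ) ^ ((9 : ℝ) / 2) := by
  have hk : 1 ≤ k := by
    have : 85 ^ 2 ≤ (n - 1) ^ 2 := Nat.pow_le_pow_left (by omega) 2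
    omega
  have hn0 : (0:ℝ) < n := by exact_mod_cast (by omega : 0 < n)
  have hp := Real.pi_pos
  have hp3 := Real.pi_gt_d2
  have hk1' : ((n:ℝ) - 1)^2 ≤ 2 * k := by
    have : (((n - 1 : ℕ):ℝ))^2 ≤ 2 * k := by exact_mod_cast hk1
    rwa [Nat.cast_sub (by omega), Nat.cast_one] at this
  have hk2' : 2 * (k:ℝ) ≤ (n:ℝ)^2 := by exact_mod_cast hk2
  rw [Aux9.diff_eq n k hk]
  have hmain := Aux9.main_int n hn ((n:ℝ)^2 - 2 * k + 1) (by linarith) (by nlinarith)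
  have e1 : (n : ℝ) ^ ((9 : ℝ) / 2) = (n:ℝ)^4 * √n := by
    rw [show (9:ℝ)/2 = ((4:ℕ):ℝ) + 1/2 by norm_num, Real.rpow_add hn0, Real.rpow_natCast,
      Real.sqrt_eq_rpow]
  have e2 : Real.pi ^ ((3 : ℝ) / 2) = Real.pi * √Real.pi := by
    rw [show (3:ℝ)/2 = 1 + 1/2 by norm_num, Real.rpow_add hp, Real.rpow_one, Real.sqrt_eq_rpow]
  rw [e1, e2]
  set Q := (n:ℝ)^4 * √n
  have hQ0 : 0 < Q := by positivity
  have s3 : √(3:ℝ) ≤ 1.8 := Real.sqrt_le_iff.2 ⟨by norm_num, by norm_num⟩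
  have s2 : 1.4 ≤ √(2:ℝ) := Real.le_sqrt_of_sq_le (by norm_num)
  have sp : 1.7 ≤ √Real.pi := Real.le_sqrt_of_sq_le (by norm_num; linarith)
  have key : 3 * √3 / (2 * √2 * (Real.pi * √Real.pi)) ≤ 4 / Real.pi * 0.35 := by
    rw [div_le_iff₀ (by positivity)]
    have : 4 / Real.pi * 0.35 * (2 * √2 * (Real.pi * √Real.pi)) = 2.8 * (√2 * √Real.pi) := by
      field_simp; ring
    rw [this]
    have : 1.4 * 1.7 ≤ √2 * √Real.pi := by gcongr
    linarith
  calc 3 * √3 / (2 * √2 * (Real.pi * √Real.pi)) * 2 ^ n / Q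
      ≤ (4 / Real.pi * 0.35) * 2 ^ n / Q := by gcongr
    _ = 2 ^ n * (4 / Real.pi) * (0.35 / Q) := by ring
    _ ≤ _ := by gcongr
end
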